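/- CVI can be rewritten as the sum of four non-negative terms: v(a,b) = ((n_a - n_{ab})/N)·log(N/n_a) + ((n_b - n_{ab})/N)·log(N/n_b) + (n_{ab}/N)·log(n_a/n_{ab}) + (n_{ab}/N)·log(n_b/n_{ab}). -/

import Mathlib

/-- CVI can be rewritten as a sum of four non-negative terms. -/
theorem cvi_decomposition (N na nb nab : ℕ)
    (hna : 0 < na) (hnaN : na ≤ N) (hnb : 0 < nb) (hnbN : nb ≤ N)
    (hab0 : 0 < nab) (hab : nab ≤ min na nb) :
    (-((na : ℝ) / N) * Real.log ((na : ℝ) / N)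
        + -((nb : ℝ) / N) * Real.log ((nb : ℝ) / N)
        - 2 * (((nab : ℝ) / N) * Real.log ((nab : ℝ) * N / ((na : ℝ) * nb))))
      = (((na : ℝ) - nab) / N) * Real.log ((N : ℝ) / na)
        + (((nb : ℝ) - nab) / N) * Real.log ((N : ℝ) / nb)
        + ((nab : ℝ) / N) * Real.log ((na : ℝ) / nab)
        + ((nab : ℝ) / N) * Real.log ((nb : ℝ) / nab)
    ∧ 0 ≤ (((na : ℝ) - nab) / N) * Real.log ((N : ℝ) / na)
    ∧ 0 ≤ (((nb : ℝ) - nab) / N) * Real.log ((N : ℝ) / nb)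
    ∧ 0 ≤ ((nab : ℝ) / N) * Real.log ((na : ℝ) / nab)
    ∧ 0 ≤ ((nab : ℝ) / N) * Real.log ((nb : ℝ) / nab) := by
  obtain ⟨haba, habb⟩ := le_min_iff.mp hab
  have hN : (0 : ℝ) < N := by exact_mod_cast hna.trans_le hnaN
  have ha : (0 : ℝ) < na := by exact_mod_cast hna
  have hb : (0 : ℝ) < nb := by exact_mod_cast hnb
  have hc : (0 : ℝ) < nab := by exact_mod_cast hab0
  have haN : (na : ℝ) ≤ N := by exact_mod_cast hnaN
  have hbN : (nb : ℝ) ≤ N := by exact_mod_cast hnbN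
  have hca : (nab : ℝ) ≤ na := by exact_mod_cast haba
  have hcb : (nab : ℝ) ≤ nb := by exact_mod_cast habb
  refine ⟨?_, ?_, ?_, ?_, ?_⟩
  · rw [Real.log_div (mul_pos hc hN).ne' (mul_pos ha hb).ne', Real.log_mul hc.ne' hN.ne',
      Real.log_mul ha.ne' hb.ne', Real.log_div ha.ne' hN.ne', Real.log_div hb.ne' hN.ne',
      Real.log_div hN.ne' ha.ne', Real.log_div hN.ne' hb.ne', Real.log_div ha.ne' hc.ne',
      Real.log_div hb.ne' hc.ne']
    ring
  · exact mul_nonneg (div_nonneg (sub_nonneg.mpr hca) hN.le)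
      (Real.log_nonneg ((one_le_div ha).mpr haN))
  · exact mul_nonneg (div_nonneg (sub_nonneg.mpr hcb) hN.le)
      (Real.log_nonneg ((one_le_div hb).mpr hbN))
  · exact mul_nonneg (div_nonneg hc.le hN.le) (Real.log_nonneg ((one_le_div hc).mpr hca))
  · exact mul_nonneg (div_nonneg hc.le hN.le) (Real.log_nonneg ((one_le_div hc).mpr hcb))
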